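/- Let N be a positive integer, k an even integer, and f : ℍ → ℂ a function transforming like a modular form of weight k for Γ₀(N). Let Q be an exact divisor of N, W_Q any Atkin-Lehner matrix for Q at level N, and m a positive integer with gcd(m, Q) = 1. Then the Atkin-Lehner operator commutes with the m-th Hecke operator at level N: (f∣ₖW_Q)∣T_m^{(N)} = (f∣T_m^{(N)})∣ₖW_Q. -/

import Mathlib

noncomputable section

open Complex Matrix Finset UpperHalfPlane

/-- Möbius action of a real `2×2` matrix on the upper half-plane (this is the genuine
Möbius action `τ ↦ (aτ+b)/(cτ+d)` whenever the matrix has positive determinant). -/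
def moebius (g : Matrix (Fin 2) (Fin 2) ℝ) (τ : UpperHalfPlane) : UpperHalfPlane :=
  if h : 0 < ((((g 0 0 : ℝ) : ℂ) * (τ : ℂ) + ((g 0 1 : ℝ) : ℂ)) /
      (((g 1 0 : ℝ) : ℂ) * (τ : ℂ) + ((g 1 1 : ℝ) : ℂ))).im then
    UpperHalfPlane.mk _ h else τ

/-- The weight-`k` slash action of a real `2×2` matrix, normalized with `det ^ (k/2)`. -/
def slash (k : ℤ) (g : Matrix (Fin 2) (Fin 2) ℝ) (f : UpperHalfPlane → ℂ) :
    UpperHalfPlane → ℂ :=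
  fun τ => ((g.det : ℝ) : ℂ) ^ ((k : ℂ) / 2) *
    (((g 1 0 : ℝ) : ℂ) * (τ : ℂ) + ((g 1 1 : ℝ) : ℂ)) ^ (-k) * f (moebius g τ)

/-- `g` is (the image in `SL₂(ℝ)` of) an integer matrix of determinant `1` whose
lower-left entry is divisible by `N`, i.e. an element of `Γ₀(N)`. -/
def MemGamma0 (N : ℕ) (g : Matrix (Fin 2) (Fin 2) ℝ) : Prop :=
  (∃ a b c d : ℤ, g = !![(a : ℝ), (b : ℝ); (c : ℝ), (d : ℝ)] ∧ (N : ℤ) ∣ c) ∧ g.det = 1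

/-- `f` transforms like a modular form of weight `k` for `Γ₀(N)`. -/
def TransformsLike (N : ℕ) (k : ℤ) (f : UpperHalfPlane → ℂ) : Prop :=
  ∀ g, MemGamma0 N g → slash k g f = f

/-- An Atkin-Lehner matrix for the exact divisor `Q` at level `N`:
`W_Q = (1/√Q)·(Qx, y; Nz, Qt)` with integer entries and determinant `1`. -/
def IsAtkinLehner (N Q : ℕ) (W : Matrix (Fin 2) (Fin 2) ℝ) : Prop :=
  (∃ x y z t : ℤ,
      W = (Real.sqrt Q)⁻¹ • !![(Q : ℝ) * x, (y : ℝ); (N : ℝ) * z, (Q : ℝ) * t]) ∧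
    W.det = 1

/-- The matrix `B_m = (1/√m)·(m, 0; 0, 1)`. -/
def Bmat (m : ℕ) : Matrix (Fin 2) (Fin 2) ℝ :=
  (Real.sqrt m)⁻¹ • !![(m : ℝ), 0; 0, 1]

/-- The `m`-th Hecke operator of weight `k` and level `N`:
`(f∣T_m)(τ) = m^{k/2−1} Σ_{ad = m, gcd(a,N)=1} Σ_{b=0}^{d−1} (f∣ₖ(a, b; 0, d))(τ)`. -/
def hecke (N : ℕ) (k : ℤ) (m : ℕ) (f : UpperHalfPlane → ℂ) : UpperHalfPlane → ℂ :=
  fun τ => (m : ℂ) ^ ((k : ℂ) / 2 - 1) *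
    ∑ a ∈ m.divisors, if Nat.gcd a N = 1 then
      ∑ b ∈ Finset.range (m / a), slash k !![(a : ℝ), (b : ℝ); 0, ((m / a : ℕ) : ℝ)] f τ
    else 0

/-- The weight-`0` operator `U_m`: `(f∣U_m)(τ) = (1/m) Σ_{j=0}^{m−1} f((τ+j)/m)`. -/
def U0 (m : ℕ) (f : UpperHalfPlane → ℂ) : UpperHalfPlane → ℂ :=
  fun τ => (1 / (m : ℂ)) * ∑ j ∈ Finset.range m, f (moebius !![1, (j : ℝ); 0, (m : ℝ)] τ)

/-- The weight-`0` operator `B_m`: `(f∣B_m)(τ) = f(mτ)`. -/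
def B0 (m : ℕ) (f : UpperHalfPlane → ℂ) : UpperHalfPlane → ℂ :=
  fun τ => f (moebius !![(m : ℝ), 0; 0, 1] τ)

/-- The weight-`0` action of a matrix: `(f∣W)(τ) = f(W·τ)`. -/
def W0 (W : Matrix (Fin 2) (Fin 2) ℝ) (f : UpperHalfPlane → ℂ) : UpperHalfPlane → ℂ :=
  fun τ => f (moebius W τ)

/-- `f` is invariant under `Γ₀(N)` in weight `0`. -/
def Inv0 (N : ℕ) (f : UpperHalfPlane → ℂ) : Prop :=
  ∀ g, MemGamma0 N g → ∀ τ, f (moebius g τ) = f τ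

theorem fin_two_congr {R : Type*} {a b c d a' b' c' d' : R} (ha : a = a') (hb : b = b')
    (hc : c = c') (hd : d = d') : !![a, b; c, d] = !![a', b'; c', d'] := by
  rw [ha, hb, hc, hd]

theorem mul_left_cancel_of_det_ne_zero {V A B : Matrix (Fin 2) (Fin 2) ℤ} (hV : V.det ≠ 0)
    (h : V * A = V * B) : A = B := by
  have := congrArg (V.adjugate * ·) h
  simp only [← Matrix.mul_assoc, Matrix.adjugate_mul, Matrix.smul_mul, Matrix.one_mul] at this
  exact smul_right_injective _ hV this

theorem denom_ne_zero_of_det_pos {g : Matrix (Fin 2) (Fin 2) ℝ} (hg : 0 < g.det)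
    (τ : UpperHalfPlane) : ((g 1 0 : ℝ) : ℂ) * (τ : ℂ) + ((g 1 1 : ℝ) : ℂ) ≠ 0 := by
  intro h
  have him := congrArg Complex.im h
  have hre := congrArg Complex.re h
  have hτ := τ.im_pos.ne'
  simp only [Complex.add_im, Complex.mul_im, Complex.ofReal_re, Complex.ofReal_im, zero_mul,
    add_zero, Complex.zero_im, UpperHalfPlane.coe_im, mul_eq_zero, hτ, or_false] at him
  simp only [him, Complex.add_re, Complex.mul_re, Complex.ofReal_re, Complex.ofReal_im, zero_mul,
    sub_zero, zero_add, Complex.zero_re] at hre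
  simp [Matrix.det_fin_two, him, hre] at hg

theorem coe_moebius {g : Matrix (Fin 2) (Fin 2) ℝ} (hg : 0 < g.det) (τ : UpperHalfPlane) :
    (moebius g τ : ℂ) = (((g 0 0 : ℝ) : ℂ) * (τ : ℂ) + ((g 0 1 : ℝ) : ℂ)) /
      (((g 1 0 : ℝ) : ℂ) * (τ : ℂ) + ((g 1 1 : ℝ) : ℂ)) := by
  have hn := Complex.normSq_pos.2 (denom_ne_zero_of_det_pos hg τ)
  have him : ((((g 0 0 : ℝ) : ℂ) * (τ : ℂ) + ((g 0 1 : ℝ) : ℂ)) /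
      (((g 1 0 : ℝ) : ℂ) * (τ : ℂ) + ((g 1 1 : ℝ) : ℂ))).im =
      g.det * τ.im / Complex.normSq (((g 1 0 : ℝ) : ℂ) * (τ : ℂ) + ((g 1 1 : ℝ) : ℂ)) := by
    rw [Complex.div_im, ← sub_div, Matrix.det_fin_two]
    congr 1
    simp
    ring
  have hpos : 0 < ((((g 0 0 : ℝ) : ℂ) * (τ : ℂ) + ((g 0 1 : ℝ) : ℂ)) /
      (((g 1 0 : ℝ) : ℂ) * (τ : ℂ) + ((g 1 1 : ℝ) : ℂ))).im := by
    rw [him]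
    exact div_pos (mul_pos hg τ.im_pos) hn
  rw [moebius, dif_pos hpos]

theorem denom_moebius_mul_denom {g : Matrix (Fin 2) (Fin 2) ℝ} (hg : 0 < g.det)
    (h : Matrix (Fin 2) (Fin 2) ℝ) (i : Fin 2) (τ : UpperHalfPlane) :
    (((h i 0 : ℝ) : ℂ) * (moebius g τ : ℂ) + ((h i 1 : ℝ) : ℂ)) *
      (((g 1 0 : ℝ) : ℂ) * (τ : ℂ) + ((g 1 1 : ℝ) : ℂ)) =
      (((h * g) i 0 : ℝ) : ℂ) * (τ : ℂ) + (((h * g) i 1 : ℝ) : ℂ) := by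
  have := denom_ne_zero_of_det_pos hg τ
  rw [coe_moebius hg, add_mul, mul_assoc, div_mul_cancel₀ _ this]
  simp only [Matrix.mul_apply, Fin.sum_univ_two]
  push_cast
  ring

theorem moebius_mul {g h : Matrix (Fin 2) (Fin 2) ℝ} (hg : 0 < g.det) (hh : 0 < h.det)
    (τ : UpperHalfPlane) : moebius (h * g) τ = moebius h (moebius g τ) := by
  have hhg : 0 < (h * g).det := by rw [Matrix.det_mul]; exact mul_pos hh hg
  ext1
  rw [coe_moebius hhg, coe_moebius hh, ← denom_moebius_mul_denom hg h 0,
    ← denom_moebius_mul_denom hg h 1, mul_div_mul_right _ _ (denom_ne_zero_of_det_pos hg τ)]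

theorem slash_slash {g h : Matrix (Fin 2) (Fin 2) ℝ} (hg : 0 < g.det) (hh : 0 < h.det)
    (k : ℤ) (f : UpperHalfPlane → ℂ) : slash k g (slash k h f) = slash k (h * g) f := by
  funext τ
  simp only [slash]
  rw [moebius_mul hg hh, ← denom_moebius_mul_denom hg h 1, mul_zpow, Matrix.det_mul,
    Complex.ofReal_mul, Complex.mul_cpow_ofReal_nonneg hh.le hg.le]
  ring

/-- Integer matrices of determinant `m` whose reduction modulo `N` is upper triangular with
invertible upper-left entry. -/
structure IsHeckeMatrix (N : ℕ) (m : ℤ) (A : Matrix (Fin 2) (Fin 2) ℤ) : Prop where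
  det_eq : A.det = m
  dvd : (N : ℤ) ∣ A 1 0
  coprime : IsCoprime (A 0 0) (N : ℤ)

/-- The pairs `(a, b)` indexing the summands of the Hecke operator. -/
def heckeIndex (N m : ℕ) : Finset (Σ _ : ℕ, ℕ) :=
  {a ∈ m.divisors | Nat.gcd a N = 1}.sigma fun a => Finset.range (m / a)

/-- The matrix `(a, b; 0, m / a)`. -/
def heckeRep (m : ℕ) (p : Σ _ : ℕ, ℕ) : Matrix (Fin 2) (Fin 2) ℤ :=
  !![(p.1 : ℤ), (p.2 : ℤ); 0, ((m / p.1 : ℕ) : ℤ)]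

theorem mem_heckeIndex {N m : ℕ} (hm : 0 < m) {p : Σ _ : ℕ, ℕ} :
    p ∈ heckeIndex N m ↔ p.1 ∣ m ∧ Nat.gcd p.1 N = 1 ∧ p.2 < m / p.1 := by
  simp [heckeIndex, hm.ne', and_assoc]

theorem isHeckeMatrix_heckeRep {N m : ℕ} (hm : 0 < m) {p : Σ _ : ℕ, ℕ}
    (hp : p ∈ heckeIndex N m) : IsHeckeMatrix N m (heckeRep m p) := by
  obtain ⟨hd, hc, -⟩ := (mem_heckeIndex hm).1 hp
  refine ⟨?_, by simp [heckeRep], ?_⟩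
  · simp only [heckeRep, Matrix.det_fin_two_of, mul_zero, sub_zero]
    exact_mod_cast Nat.mul_div_cancel' hd
  · simpa [heckeRep] using Nat.isCoprime_iff_coprime.2 hc

theorem IsHeckeMatrix.of_det_one {N : ℕ} {A : Matrix (Fin 2) (Fin 2) ℤ} (hdet : A.det = 1)
    (hdvd : (N : ℤ) ∣ A 1 0) : IsHeckeMatrix N 1 A := by
  refine ⟨hdet, hdvd, ?_⟩
  obtain ⟨e, he⟩ := hdvd
  rw [Matrix.det_fin_two] at hdet
  exact ⟨A 1 1, -(A 0 1 * e), by rw [he] at hdet; linear_combination hdet⟩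

theorem IsHeckeMatrix.mul {N : ℕ} {A B : Matrix (Fin 2) (Fin 2) ℤ}
    (hA : IsHeckeMatrix N 1 A) (hB : IsHeckeMatrix N 1 B) : IsHeckeMatrix N 1 (A * B) := by
  refine .of_det_one (by rw [Matrix.det_mul, hA.det_eq, hB.det_eq, one_mul]) ?_
  simp only [Matrix.mul_apply, Fin.sum_univ_two]
  exact dvd_add (hA.dvd.mul_right _) (hB.dvd.mul_left _)

theorem IsHeckeMatrix.adjugate {N : ℕ} {A : Matrix (Fin 2) (Fin 2) ℤ}
    (hA : IsHeckeMatrix N 1 A) : IsHeckeMatrix N 1 A.adjugate := by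
  refine .of_det_one (by simp [Matrix.det_adjugate, hA.det_eq]) ?_
  simpa [Matrix.adjugate_fin_two] using hA.dvd

theorem IsHeckeMatrix.exists_eq_mul_heckeRep {N m : ℕ} (hm : 0 < m)
    {A : Matrix (Fin 2) (Fin 2) ℤ} (hA : IsHeckeMatrix N m A) :
    ∃ p ∈ heckeIndex N m, ∃ γ, IsHeckeMatrix N 1 γ ∧ A = γ * heckeRep m p := by
  obtain ⟨hdet, hdvd, hcop⟩ := hA
  rw [Matrix.det_fin_two] at hdet
  have hm' : (0 : ℤ) < m := by exact_mod_cast hm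
  have hg : 0 < Int.gcd (A 0 0) (A 1 0) := by
    rw [Int.gcd_pos_iff]
    by_contra! h
    rw [h.1, h.2] at hdet
    linarith
  obtain ⟨g, a, c, hg0, hac, ha, hc⟩ := Int.exists_gcd_one' hg
  have hac' : IsCoprime a c := Int.isCoprime_iff_gcd_eq_one.2 hac
  obtain ⟨u, v, huv⟩ := hac'
  have hg0' : (0 : ℤ) < g := by exact_mod_cast hg0
  have hgN : IsCoprime (g : ℤ) (N : ℤ) := by
    rw [ha] at hcop
    exact hcop.of_mul_left_right
  have hmg : (m : ℤ) = g * (a * A 1 1 - A 0 1 * c) := by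
    rw [← hdet, ha, hc]; ring
  have hgm : g ∣ m := by exact_mod_cast Dvd.intro _ hmg.symm
  have hD : ((m / g : ℕ) : ℤ) = a * A 1 1 - A 0 1 * c := by
    rw [Int.natCast_div, hmg, Int.mul_ediv_cancel_left _ hg0'.ne']
  have hD0 : (0 : ℤ) < ((m / g : ℕ) : ℤ) := by
    exact_mod_cast Nat.div_pos (Nat.le_of_dvd hm hgm) hg0
  have hr0 := Int.emod_nonneg (u * A 0 1 + v * A 1 1) hD0.ne'
  have hr1 := Int.emod_lt_of_pos (u * A 0 1 + v * A 1 1) hD0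
  have hqr := Int.emod_add_mul_ediv (u * A 0 1 + v * A 1 1) ((m / g : ℕ) : ℤ)
  generalize (u * A 0 1 + v * A 1 1) % ((m / g : ℕ) : ℤ) = r at hr0 hr1 hqr
  generalize (u * A 0 1 + v * A 1 1) / ((m / g : ℕ) : ℤ) = q at hqr
  lift r to ℕ using hr0
  refine ⟨⟨g, r⟩, (mem_heckeIndex hm).2 ⟨hgm, Nat.isCoprime_iff_coprime.1 hgN,
    by exact_mod_cast hr1⟩, !![a, a * q - v; c, c * q + u], .of_det_one ?_ ?_, ?_⟩
  · rw [Matrix.det_fin_two_of]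
    linear_combination huv
  · rw [hc] at hdvd
    exact hgN.symm.dvd_of_dvd_mul_right hdvd
  · rw [Matrix.eta_fin_two A, heckeRep, Matrix.mul_fin_two]
    apply fin_two_congr
    · linear_combination ha
    · linear_combination (-A 0 1) * huv - a * hqr + v * hD
    · linear_combination hc
    · linear_combination (-A 1 1) * huv - c * hqr - u * hD

theorem heckeRep_injective {N m : ℕ} (hm : 0 < m) {p p' : Σ _ : ℕ, ℕ}
    (hp : p ∈ heckeIndex N m) (hp' : p' ∈ heckeIndex N m) {γ : Matrix (Fin 2) (Fin 2) ℤ}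
    (hγ : γ.det = 1) (h : heckeRep m p' = γ * heckeRep m p) : p' = p := by
  obtain ⟨a, b⟩ := p
  obtain ⟨a', b'⟩ := p'
  obtain ⟨hd, -, hb⟩ := (mem_heckeIndex hm).1 hp
  obtain ⟨hd', -, hb'⟩ := (mem_heckeIndex hm).1 hp'
  dsimp only at hd hb hd' hb'
  have ha : (0 : ℤ) < a := by exact_mod_cast Nat.pos_of_dvd_of_pos hd hm
  have ha' : (0 : ℤ) < a' := by exact_mod_cast Nat.pos_of_dvd_of_pos hd' hm
  have h00 := congrFun₂ h 0 0
  have h01 := congrFun₂ h 0 1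
  have h10 := congrFun₂ h 1 0
  simp [heckeRep, Matrix.mul_apply] at h00 h01 h10
  rw [Matrix.det_fin_two] at hγ
  have hc : γ 1 0 = 0 := by
    rcases h10 with h | h
    · exact h
    · omega
  rw [hc, mul_zero, sub_zero] at hγ
  have he : γ 0 0 = 1 := by
    rcases Int.eq_one_or_neg_one_of_mul_eq_one hγ with h | h
    · exact h
    · rw [h] at h00; linarith
  rw [he, one_mul] at h00 h01
  obtain rfl : a' = a := by exact_mod_cast h00
  have hbb : (b' : ℤ) % ((m / a' : ℕ) : ℤ) = (b : ℤ) % ((m / a' : ℕ) : ℤ) := by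
    rw [h01, Int.natCast_div, Int.add_mul_emod_self_right]
  rw [Int.emod_eq_of_lt (by positivity) (by exact_mod_cast hb'),
    Int.emod_eq_of_lt (by positivity) (by exact_mod_cast hb)] at hbb
  rw [Int.natCast_inj.1 hbb]

theorem IsHeckeMatrix.exists_atkinLehner_conj {Q M : ℕ} {m x y z t : ℤ}
    (hdet : Q * x * t - M * y * z = 1) (hm : IsCoprime m (Q : ℤ))
    {A : Matrix (Fin 2) (Fin 2) ℤ} (hA : IsHeckeMatrix (Q * M) m A) :
    ∃ B, IsHeckeMatrix (Q * M) m B ∧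
      !![Q * x, y; ((Q * M : ℕ) : ℤ) * z, Q * t] * A =
        B * !![Q * x, y; ((Q * M : ℕ) : ℤ) * z, Q * t] := by
  obtain ⟨hd, ⟨c, hc⟩, hcop⟩ := hA
  rw [Matrix.det_fin_two] at hd
  push_cast at hc hcop ⊢
  rw [hc] at hd
  refine ⟨!![(Q * x * A 0 0 + y * A 1 0) * t - (Q * x * A 0 1 + y * A 1 1) * M * z,
    -(x * A 0 0 * y) - y ^ 2 * M * c + (Q * x * A 0 1 + y * A 1 1) * x;
    Q * M * ((z * A 0 0 + Q * t * c) * t - (M * z * A 0 1 + t * A 1 1) * z),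
    -((M * z * A 0 0 + Q * M * t * c) * y) + (Q * M * z * A 0 1 + Q * t * A 1 1) * x],
    ⟨?_, ?_, ?_⟩, ?_⟩
  · rw [Matrix.det_fin_two_of, hc, ← hd]
    linear_combination (A 0 0 * A 1 1 - A 0 1 * (Q * M * c)) * (Q * x * t - M * y * z + 1) * hdet
  · simp
  · simp only [Matrix.of_apply, Matrix.cons_val', Matrix.cons_val_zero, hc]
    push_cast
    refine IsCoprime.mul_right ?_ ?_
    · have h1 : IsCoprime (A 1 1) (Q : ℤ) := by
        have : IsCoprime (A 0 0 * A 1 1) (Q : ℤ) := by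
          have := hm.add_mul_left_left (A 0 1 * M * c)
          rwa [show (m : ℤ) + Q * (A 0 1 * M * c) = A 0 0 * A 1 1 by linear_combination -hd] at this
        exact this.of_mul_left_right
      rw [show (Q * x * A 0 0 + y * (Q * M * c)) * t - (Q * x * A 0 1 + y * A 1 1) * M * z =
        A 1 1 + Q * (x * t * A 0 0 + y * M * c * t - x * A 0 1 * M * z - A 1 1 * x * t) by
          linear_combination A 1 1 * hdet]
      exact h1.add_mul_left_left _
    · have h1 : IsCoprime (A 0 0) (M : ℤ) := hcop.of_mul_right_right
      rw [show (Q * x * A 0 0 + y * (Q * M * c)) * t - (Q * x * A 0 1 + y * A 1 1) * M * z =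
        A 0 0 + M * (y * Q * c * t - (Q * x * A 0 1 + y * A 1 1) * z + A 0 0 * y * z) by
          linear_combination A 0 0 * hdet]
      exact h1.add_mul_left_left _
  · rw [Matrix.eta_fin_two A, Matrix.mul_fin_two, Matrix.mul_fin_two]
    simp only [Matrix.of_apply, Matrix.cons_val', Matrix.cons_val_zero, Matrix.cons_val_one,
      Matrix.cons_val_fin_one, hc]
    apply fin_two_congr
    · linear_combination (-(Q * x * A 0 0 + y * (Q * M * c))) * hdet
    · linear_combination (-(Q * x * A 0 1 + y * A 1 1)) * hdet
    · linear_combination (-(Q * M * z * A 0 0 + Q * t * (Q * M * c))) * hdet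
    · linear_combination (-(Q * M * z * A 0 1 + Q * t * A 1 1)) * hdet

theorem hecke_apply (N : ℕ) (k : ℤ) (m : ℕ) (f : UpperHalfPlane → ℂ) (τ : UpperHalfPlane) :
    hecke N k m f τ = (m : ℂ) ^ ((k : ℂ) / 2 - 1) *
      ∑ p ∈ heckeIndex N m, slash k ((heckeRep m p).map (Int.cast : ℤ → ℝ)) f τ := by
  rw [hecke, heckeIndex, Finset.sum_sigma, Finset.sum_filter]
  congr! 5 with a _ _ b _
  ext i j
  fin_cases i <;> fin_cases j <;> simp [heckeRep, -Int.natCast_ediv, -Nat.cast_div]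

theorem TransformsLike.slash_map_eq {N : ℕ} {k : ℤ} {f : UpperHalfPlane → ℂ}
    (hf : TransformsLike N k f) {γ : Matrix (Fin 2) (Fin 2) ℤ} (hγ : IsHeckeMatrix N 1 γ) :
    slash k (γ.map (Int.cast : ℤ → ℝ)) f = f := by
  refine hf _ ⟨⟨γ 0 0, γ 0 1, γ 1 0, γ 1 1, ?_, hγ.dvd⟩, ?_⟩
  · exact Matrix.eta_fin_two _
  · rw [← Int.cast_det, hγ.det_eq, Int.cast_one]

/-- For an exact divisor `Q` of `N`, a positive integer `m` with
`gcd(m, Q) = 1`, and `f` transforming like a modular form of even weight `k` for `Γ₀(N)`,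
the Atkin-Lehner operator `W_Q` commutes with the Hecke operator `T_m` at level `N`:
`(f∣ₖW_Q)∣T_m = (f∣T_m)∣ₖW_Q`. -/
theorem atkinLehner_hecke_comm (N : ℕ) (hN : 0 < N) (k : ℤ) (hk : Even k)
    (f : UpperHalfPlane → ℂ) (hf : TransformsLike N k f)
    (Q : ℕ) (hQ : Q ∣ N) (hQe : Nat.gcd Q (N / Q) = 1)
    (W : Matrix (Fin 2) (Fin 2) ℝ) (hW : IsAtkinLehner N Q W)
    (m : ℕ) (hm : 0 < m) (hmQ : Nat.gcd m Q = 1) :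
    hecke N k m (slash k W f) = slash k W (hecke N k m f) := by
  obtain ⟨⟨x, y, z, t, hWeq⟩, hW1⟩ := hW
  obtain ⟨M, rfl⟩ := hQ
  have hQ0 : 0 < Q := Nat.pos_of_mul_pos_right hN
  have hdet : (Q : ℤ) * x * t - M * y * z = 1 := by
    have hQR : (0 : ℝ) < Q := by exact_mod_cast hQ0
    rw [hWeq, Matrix.det_smul, Matrix.det_fin_two_of, Fintype.card_fin, inv_pow,
      Real.sq_sqrt hQR.le] at hW1
    push_cast at hW1
    have : (Q : ℝ) * x * t - M * y * z = 1 := by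
      rw [← hW1]
      field_simp
    exact_mod_cast this
  have hWint : W = (Real.sqrt Q)⁻¹ •
      (!![Q * x, y; ((Q * M : ℕ) : ℤ) * z, Q * t] : Matrix (Fin 2) (Fin 2) ℤ).map
        (Int.cast : ℤ → ℝ) := by
    rw [hWeq]
    ext i j
    fin_cases i <;> fin_cases j <;> simp
  have hWdet : (!![Q * x, y; ((Q * M : ℕ) : ℤ) * z, Q * t] : Matrix (Fin 2) (Fin 2) ℤ).det = Q := by
    rw [Matrix.det_fin_two_of]
    push_cast
    linear_combination (Q : ℤ) * hdet
  have hadj : (!![Q * x, y; ((Q * M : ℕ) : ℤ) * z, Q * t] : Matrix (Fin 2) (Fin 2) ℤ).adjugate =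
      !![Q * t, -y; ((Q * M : ℕ) : ℤ) * -z, Q * x] := by
    rw [Matrix.adjugate_fin_two_of, mul_neg]
  have hconj {n : ℤ} {A} (hn : IsCoprime n (Q : ℤ)) (hA : IsHeckeMatrix (Q * M) n A) :=
    hA.exists_atkinLehner_conj hdet hn
  have hconj' {A} (hA : IsHeckeMatrix (Q * M) 1 A) :=
    hA.exists_atkinLehner_conj (x := t) (y := -y) (z := -z) (t := x)
      (by linear_combination hdet) isCoprime_one_left
  simp only [← hadj] at hconj'
  generalize (!![Q * x, y; ((Q * M : ℕ) : ℤ) * z, Q * t] : Matrix (Fin 2) (Fin 2) ℤ) = V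
    at hWint hWdet hconj hconj'
  have hV0 : V.det ≠ 0 := by rw [hWdet]; exact_mod_cast hQ0.ne'
  have hmQ' : IsCoprime (m : ℤ) (Q : ℤ) := Nat.isCoprime_iff_coprime.2 hmQ
  have hrep : ∀ p ∈ heckeIndex (Q * M) m, ∃ p' ∈ heckeIndex (Q * M) m, ∃ γ,
      IsHeckeMatrix (Q * M) 1 γ ∧ V * heckeRep m p = γ * heckeRep m p' * V := by
    intro p hp
    obtain ⟨B, hB, hVB⟩ := hconj hmQ' (isHeckeMatrix_heckeRep hm hp)
    obtain ⟨p', hp', γ, hγ, rfl⟩ := hB.exists_eq_mul_heckeRep hm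
    exact ⟨p', hp', γ, hγ, hVB⟩
  choose! σ hσ γ hγ hVσ using hrep
  have hσinj : Set.InjOn σ (heckeIndex (Q * M) m) := by
    intro p hp p' hp' hpp
    obtain ⟨δ, hδ, hVδ⟩ := hconj' ((hγ p hp).mul (hγ p' hp').adjugate)
    have hcomm : γ p * (γ p').adjugate * V = V * δ := by
      have h := congrArg (fun X => V * X * V) hVδ
      simp only [← Matrix.mul_assoc, Matrix.mul_adjugate] at h
      simp only [Matrix.mul_assoc, Matrix.adjugate_mul, Matrix.smul_mul, Matrix.mul_smul,
        Matrix.one_mul, Matrix.mul_one] at h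
      simpa only [Matrix.mul_assoc] using smul_right_injective _ hV0 h
    refine heckeRep_injective hm hp' hp hδ.det_eq (mul_left_cancel_of_det_ne_zero hV0 ?_)
    rw [← Matrix.mul_assoc, ← hcomm, Matrix.mul_assoc _ V, hVσ p' hp', hVσ p hp, hpp]
    simp only [Matrix.mul_assoc]
    rw [← Matrix.mul_assoc (γ p').adjugate, Matrix.adjugate_mul, (hγ p' hp').det_eq, one_smul,
      Matrix.one_mul]
  have hσmaps : Set.MapsTo σ (heckeIndex (Q * M) m) (heckeIndex (Q * M) m) := hσ
  have hσsurj : Set.SurjOn σ (heckeIndex (Q * M) m) (heckeIndex (Q * M) m) :=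
    Finset.surjOn_of_injOn_of_card_le σ hσmaps hσinj le_rfl
  have hWpos : 0 < W.det := hW1 ▸ one_pos
  have hrep_pos {n : ℕ} (hn : 0 < n) {A : Matrix (Fin 2) (Fin 2) ℤ}
      (hA : IsHeckeMatrix (Q * M) n A) : 0 < (A.map (Int.cast : ℤ → ℝ)).det := by
    rw [← Int.cast_det, hA.det_eq]
    exact_mod_cast hn
  funext τ
  have hright : slash k W (hecke (Q * M) k m f) τ = (m : ℂ) ^ ((k : ℂ) / 2 - 1) *
      ∑ p ∈ heckeIndex (Q * M) m,
        slash k ((heckeRep m p).map (Int.cast : ℤ → ℝ) * W) f τ := by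
    rw [slash, hecke_apply, mul_left_comm, Finset.mul_sum]
    congr 1
    refine Finset.sum_congr rfl fun p hp => ?_
    rw [← slash_slash hWpos (hrep_pos hm (isHeckeMatrix_heckeRep hm hp)), slash.eq_def k W]
  rw [hright, hecke_apply]
  congr 1
  refine Finset.sum_nbij σ hσmaps hσinj hσsurj fun p hp => ?_
  have hreal : W * (heckeRep m p).map (Int.cast : ℤ → ℝ) =
      (γ p).map (Int.cast : ℤ → ℝ) * ((heckeRep m (σ p)).map (Int.cast : ℤ → ℝ) * W) := by
    have h := congrArg (fun X => (Int.castRingHom ℝ).mapMatrix X) (hVσ p hp)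
    simp only [map_mul, RingHom.mapMatrix_apply, Int.coe_castRingHom] at h
    rw [hWint, Matrix.smul_mul, h, Matrix.mul_smul, Matrix.mul_smul, Matrix.mul_assoc]
  have hp' := hrep_pos hm (isHeckeMatrix_heckeRep hm (hσ p hp))
  rw [slash_slash (hrep_pos hm (isHeckeMatrix_heckeRep hm hp)) hWpos, hreal,
    ← slash_slash (by rw [Matrix.det_mul]; exact mul_pos hp' hWpos)
      (hrep_pos one_pos (by exact_mod_cast hγ p hp)), hf.slash_map_eq (hγ p hp)]
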